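/- Let H be an elementary abelian 2-hypergroup, G a closed subset of H, and r ∈ ℕ₀. Then the number of all strongly normal closed subsets of G of 2^r elements equals 0 if r ∈ [0, s(G)−1], and equals C(r_2(G), r − s(G))_2 if r ∈ ℕ₀ ∖ [0, s(G)−1], where C(·,·)_2 denotes the Gaussian binomial coefficient with base 2. Moreover, the number of pairwise nonisomorphic strongly normal closed subsets of G equals r_2(G) + 1. -/

import Mathlib

namespace HyperPaper

/-- A hypergroup: hypermultiplication `hmul`, inversion `star`, identity `e`,
satisfying (H1) associativity, (H2) unique two-sided identity, (H3) exchange conditions. -/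
structure Hypergroup (H : Type*) where
  hmul : H → H → Set H
  star : H → H
  e : H
  idl : ∀ p, hmul e p = {p}
  idr : ∀ p, hmul p e = {p}
  e_unique : ∀ e' : H, (∀ p, hmul e' p = {p} ∧ hmul p e' = {p}) → e' = e
  assoc : ∀ p q r : H, (⋃ x ∈ hmul p q, hmul x r) = ⋃ x ∈ hmul q r, hmul p x
  h3l : ∀ p q r : H, p ∈ hmul q r ↔ q ∈ hmul p (star r)
  h3r : ∀ p q r : H, p ∈ hmul q r ↔ r ∈ hmul (star q) p

variable {H : Type*}

namespace Hypergroup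

/-- Product of two subsets: FG = {a : ∃ b ∈ F, c ∈ G, a ∈ bc}. -/
def smul (hg : Hypergroup H) (F G : Set H) : Set H :=
  {a | ∃ b ∈ F, ∃ c ∈ G, a ∈ hg.hmul b c}

/-- Closed subset: nonempty and G*G ⊆ G. -/
def IsClosed (hg : Hypergroup H) (G : Set H) : Prop :=
  G.Nonempty ∧ hg.smul (hg.star '' G) G ⊆ G

/-- Thin element: p*p = {e}. -/
def IsThin (hg : Hypergroup H) (p : H) : Prop := hg.hmul (hg.star p) p = {hg.e}

/-- Thick element: not thin. -/
def IsThick (hg : Hypergroup H) (p : H) : Prop := ¬ hg.IsThin p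

/-- Involution: p ≠ e and {e, p} is closed. -/
def IsInvolution (hg : Hypergroup H) (p : H) : Prop :=
  p ≠ hg.e ∧ hg.IsClosed {hg.e, p}

/-- ⟨G⟩: smallest closed subset containing G. -/
def gen (hg : Hypergroup H) (G : Set H) : Set H := ⋂₀ {C | hg.IsClosed C ∧ G ⊆ C}

/-- O_ϑ(G): the thin elements of H lying in G. -/
def Othin (hg : Hypergroup H) (G : Set H) : Set H := {p ∈ G | hg.IsThin p}

/-- F is a strongly normal closed subset of G: p*Fp ⊆ F ⊆ G for all p ∈ G. -/
def IsStronglyNormal (hg : Hypergroup H) (F G : Set H) : Prop :=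
  hg.IsClosed F ∧ hg.IsClosed G ∧ F ⊆ G ∧
    ∀ p ∈ G, hg.smul (hg.smul {hg.star p} F) {p} ⊆ F

/-- O^ϑ(G): intersection of all strongly normal closed subsets of ⟨G⟩. -/
def Osup (hg : Hypergroup H) (G : Set H) : Set H :=
  ⋂₀ {F | hg.IsStronglyNormal F (hg.gen G)}

/-- F is a normal closed subset of G. -/
def IsNormal (hg : Hypergroup H) (F G : Set H) : Prop :=
  hg.IsClosed F ∧ hg.IsClosed G ∧ F ⊆ G ∧ ∀ p ∈ G, hg.smul F {p} = hg.smul {p} F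

/-- Product of a list of subsets (empty product is {e}). -/
def listProd (hg : Hypergroup H) : List (Set H) → Set H
  | [] => {hg.e}
  | a :: l => hg.smul a (hg.listProd l)

/-- Product r_1 r_2 ⋯ r_n of a family of elements. -/
def famProd (hg : Hypergroup H) {n : ℕ} (r : Fin n → H) : Set H :=
  hg.listProd ((List.finRange n).map fun i => ({r i} : Set H))

/-- Ĝ_i: the product of the G_j with j ≠ i. -/
def cofactor (hg : Hypergroup H) {n : ℕ} (G : Fin n → Set H) (i : Fin n) : Set H :=
  hg.listProd (((List.finRange n).filter fun j => decide (j ≠ i)).map G)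

/-- H is the direct product of the normal closed subsets G_1, …, G_n. -/
def IsDirectProduct (hg : Hypergroup H) {n : ℕ} (G : Fin n → Set H) : Prop :=
  (∀ i, hg.IsNormal (G i) Set.univ) ∧
  (∀ i, hg.smul (G i) (hg.cofactor G i) = Set.univ) ∧
  (∀ i, G i ∩ hg.cofactor G i = {hg.e})

/-- r : Fin n → H is a decomposition of x with respect to the family G. -/
def IsDecomp (hg : Hypergroup H) {n : ℕ} (G : Fin n → Set H) (x : H) (r : Fin n → H) : Prop :=
  (∀ i, r i ∈ G i) ∧ x ∈ hg.famProd r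

/-- The support of x: the elements ≠ e appearing in the decomposition of x. -/
def dsupport (hg : Hypergroup H) {n : ℕ} (G : Fin n → Set H) (x : H) : Set H :=
  {y | y ≠ hg.e ∧ ∃ r, hg.IsDecomp G x r ∧ y ∈ Set.range r}

/-- The cover of x: the product r_1r_2⋯r_n for the decomposition of x. -/
def dcover (hg : Hypergroup H) {n : ℕ} (G : Fin n → Set H) (x : H) : Set H :=
  {y | ∃ r, hg.IsDecomp G x r ∧ y ∈ hg.famProd r}

/-- x is constrained: its cover equals {x}. -/
def IsConstrained (hg : Hypergroup H) {n : ℕ} (G : Fin n → Set H) (x : H) : Prop :=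
  hg.dcover G x = {x}

/-- r_2(G): the largest 2-rank of a thin closed subset of H contained in G
(equivalently, the largest k such that G contains a thin symmetric closed subset
of 2^k elements, which corresponds to an elementary abelian 2-group of 2-rank k). -/
noncomputable def rank2 (hg : Hypergroup H) (G : Set H) : ℕ :=
  sSup {k | ∃ U : Set H, hg.IsClosed U ∧ U ⊆ G ∧ (∀ u ∈ U, hg.IsThin u) ∧
    (∀ u ∈ U, hg.star u = u) ∧ U.ncard = 2 ^ k}

/-- F is a minimal generating subset of G. -/
def IsMinGen (hg : Hypergroup H) (G F : Set H) : Prop :=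
  F ⊆ G ∧ hg.gen F = G ∧ ∀ p ∈ F, hg.gen (F \ {p}) ≠ G

/-- The dimension of G: the smallest cardinality of a minimal generating subset. -/
noncomputable def dimension (hg : Hypergroup H) (G : Set H) : ℕ :=
  sInf {k | ∃ F : Set H, hg.IsMinGen G F ∧ F.Finite ∧ F.ncard = k}

/-- [F, G] = ⟨{a : ∃ b ∈ F, c ∈ G, a ∈ b*c*bc}⟩. -/
def commSet (hg : Hypergroup H) (F G : Set H) : Set H :=
  hg.gen {a | ∃ b ∈ F, ∃ c ∈ G,
    a ∈ hg.smul (hg.smul (hg.smul {hg.star b} {hg.star c}) {b}) {c}}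

/-- derived G k = G^{(k+1)}: G^{(1)} = G, G^{(r)} = [G^{(r-1)}, G]. -/
def derived (hg : Hypergroup H) (G : Set H) : ℕ → Set H
  | 0 => G
  | k + 1 => hg.commSet (hg.derived G k) G

/-- G is nilpotent: G^{(r)} = {e} for some r. -/
def IsNilpotent (hg : Hypergroup H) (G : Set H) : Prop :=
  ∃ k : ℕ, hg.derived G k = {hg.e}

/-- G is a residually thin closed subset: there is a chain {e} = F_1, …, F_n = G of
pairwise distinct closed subsets, each strongly normal in the next. -/
def IsResiduallyThin (hg : Hypergroup H) (G : Set H) : Prop :=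
  ∃ (m : ℕ) (F : Fin (m + 1) → Set H), Function.Injective F ∧
    F 0 = {hg.e} ∧ F (Fin.last m) = G ∧
    ∀ i : Fin m, hg.IsStronglyNormal (F i.castSucc) (F i.succ)

/-- x^k as a subset: x^0 = {e}, x^{k+1} = x^k · x. -/
def spow (hg : Hypergroup H) (x : H) : ℕ → Set H
  | 0 => {hg.e}
  | k + 1 => hg.smul (hg.spow x k) {x}

/-- F is a maximal closed subset of G. -/
def IsMaximalClosed (hg : Hypergroup H) (F G : Set H) : Prop :=
  hg.IsClosed F ∧ hg.IsClosed G ∧ F ⊆ G ∧ F ≠ G ∧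
    ∀ E : Set H, hg.IsClosed E → F ⊆ E → E ⊆ G → E = F ∨ E = G

/-- The Frattini closed subset of G: the intersection (inside G) of all maximal
closed subsets of G. -/
def frattini (hg : Hypergroup H) (G : Set H) : Set H :=
  G ∩ ⋂₀ {F | hg.IsMaximalClosed F G}

/-- α is an isomorphism from the closed subset F to the closed subset G. -/
def IsIso (hg : Hypergroup H) (F G : Set H) (α : H → H) : Prop :=
  Set.BijOn α F G ∧ α hg.e = hg.e ∧
    ∀ p ∈ F, ∀ q ∈ F, α '' hg.hmul p q = hg.hmul (α p) (α q)

/-- F ≃ G: there is an isomorphism from F to G. -/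
def Isomorphic (hg : Hypergroup H) (F G : Set H) : Prop := ∃ α : H → H, hg.IsIso F G α

/-- Aut(G): the automorphism group of G, realized as the subgroup of permutations of G
that fix e and preserve the hypermultiplication. -/
def autGroup (hg : Hypergroup H) (G : Set H) : Subgroup (Equiv.Perm G) where
  carrier := {σ | (∀ x : G, (x : H) = hg.e → ((σ x : H)) = hg.e) ∧
    ∀ p q x : G, (x : H) ∈ hg.hmul p q ↔ ((σ x : H)) ∈ hg.hmul (σ p) (σ q)}
  one_mem' := by
    constructor
    · intro x hx; simpa using hx
    · intro p q x; simp
  mul_mem' := by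
    rintro σ τ ⟨he1, hm1⟩ ⟨he2, hm2⟩
    refine ⟨fun x hx => ?_, fun p q x => ?_⟩
    · simpa using he1 _ (he2 x hx)
    · simpa using (hm2 p q x).trans (hm1 (τ p) (τ q) (τ x))
  inv_mem' := by
    rintro σ ⟨he, hm⟩
    refine ⟨fun x hx => ?_, fun p q x => ?_⟩
    · have h2 : σ x = x := Subtype.ext ((he x hx).trans hx.symm)
      have h3 : σ⁻¹ x = x := by
        conv_lhs => rw [← h2]
        simp
      rw [h3]; exact hx
    · have h := hm (σ⁻¹ p) (σ⁻¹ q) (σ⁻¹ x)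
      simpa using h.symm

end Hypergroup

/-- An elementary abelian 2-hypergroup: a hypergroup that is the constrained direct
product of the closed subsets ⟨q_1⟩, …, ⟨q_n⟩ generated by involutions q_1, …, q_n. -/
structure EA2Data (H : Type*) where
  hg : Hypergroup H
  n : ℕ
  q : Fin n → H
  invol : ∀ i, hg.IsInvolution (q i)
  dp : hg.IsDirectProduct fun i => hg.gen {q i}
  constrained : ∀ x : H, hg.IsConstrained (fun i => hg.gen {q i}) x

namespace EA2Data

/-- The family ⟨q_1⟩, …, ⟨q_n⟩. -/
def fam (E : EA2Data H) : Fin E.n → Set H := fun i => E.hg.gen {E.q i}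

/-- The support of x. -/
def support (E : EA2Data H) (x : H) : Set H := E.hg.dsupport E.fam x

/-- Thick(F): externally thick elements of H lying in F. -/
def ThickIn (E : EA2Data H) (F : Set H) : Set H :=
  {x ∈ F | x = E.hg.e ∨ ∀ y ∈ E.support x, E.hg.IsThick y}

/-- Thin(F): externally thin elements of H lying in F. -/
def ThinIn (E : EA2Data H) (F : Set H) : Set H :=
  {x ∈ F | x = E.hg.e ∨ ∀ y ∈ E.support x, E.hg.IsThin y}

/-- The (unique) pair (x⁺, x⁻) with x⁺ ∈ Thick(H), x⁻ ∈ Thin(H), x⁺x⁻ = {x}. -/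
noncomputable def pm (E : EA2Data H) (x : H) : H × H :=
  @Classical.epsilon (H × H) ⟨(E.hg.e, E.hg.e)⟩ fun z =>
    z.1 ∈ E.ThickIn Set.univ ∧ z.2 ∈ E.ThinIn Set.univ ∧ E.hg.hmul z.1 z.2 = {x}

/-- x⁺. -/
noncomputable def plus (E : EA2Data H) (x : H) : H := (E.pm x).1

/-- x⁻. -/
noncomputable def minus (E : EA2Data H) (x : H) : H := (E.pm x).2

/-- s(x): the number of thick elements of H in the support of x. -/
noncomputable def sElem (E : EA2Data H) (x : H) : ℕ :=
  {y ∈ E.support x | E.hg.IsThick y}.ncard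

/-- s(G) = max {s(a) : a ∈ G}. -/
noncomputable def sSet (E : EA2Data H) (G : Set H) : ℕ :=
  sSup {k | ∃ a ∈ G, E.sElem a = k}

/-- x ⪯ y: the support of x is contained in the support of y. -/
def ple (E : EA2Data H) (x y : H) : Prop := E.support x ⊆ E.support y

/-- p♯: the number of thick elements among q_1, …, q_n. -/
noncomputable def psharp (E : EA2Data H) : ℕ := {i : Fin E.n | E.hg.IsThick (E.q i)}.ncard

end EA2Data

/-- The Gaussian binomial coefficient C(n, k)_2 with base 2, via the
q-Pascal recurrence C(n, k)_2 = C(n-1, k-1)_2 + 2^k · C(n-1, k)_2. -/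
def gaussBinom2 : ℕ → ℕ → ℕ
  | _, 0 => 1
  | 0, _ + 1 => 0
  | n + 1, k + 1 => gaussBinom2 n k + 2 ^ (k + 1) * gaussBinom2 n (k + 1)

end HyperPaper

open HyperPaper

namespace HyperPaper

namespace Hypergroup

variable {H : Type*} (hg : Hypergroup H)

theorem e_mem_star_mul (p : H) : hg.e ∈ hg.hmul (hg.star p) p :=
  (hg.h3r p p hg.e).mp (by simp [hg.idr])

theorem star_star (p : H) : hg.star (hg.star p) = p := by
  have h := (hg.h3r _ _ _).mp (hg.e_mem_star_mul p)
  rw [hg.idr] at h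
  exact h.symm

variable {hg} in
theorem eq_star_of_e_mem {p q : H} (h : hg.e ∈ hg.hmul p q) : q = hg.star p := by
  have h := (hg.h3r _ _ _).mp h
  rwa [hg.idr] at h

theorem hmul_nonempty (p q : H) : (hg.hmul p q).Nonempty := by
  have h : q ∈ ⋃ x ∈ hg.hmul p q, hg.hmul (hg.star p) x := by
    rw [← hg.assoc]
    exact Set.mem_biUnion (hg.e_mem_star_mul p) (by simp [hg.idl])
  simp only [Set.mem_iUnion] at h
  obtain ⟨x, hx, -⟩ := h
  exact ⟨x, hx⟩

theorem mem_smul {F G : Set H} {a : H} :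
    a ∈ hg.smul F G ↔ ∃ b ∈ F, ∃ c ∈ G, a ∈ hg.hmul b c := Iff.rfl

theorem smul_singleton (p q : H) : hg.smul {p} {q} = hg.hmul p q := by
  ext
  simp [mem_smul]

theorem e_smul (F : Set H) : hg.smul {hg.e} F = F := by
  ext
  simp [mem_smul, hg.idl]

theorem smul_e (F : Set H) : hg.smul F {hg.e} = F := by
  ext
  simp [mem_smul, hg.idr]

theorem smul_assoc (A B C : Set H) :
    hg.smul (hg.smul A B) C = hg.smul A (hg.smul B C) := by
  ext z
  have key : ∀ p q r, (∃ x ∈ hg.hmul p q, z ∈ hg.hmul x r) ↔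
      ∃ x ∈ hg.hmul q r, z ∈ hg.hmul p x := fun p q r => by
    simpa using Set.ext_iff.mp (hg.assoc p q r) z
  constructor
  · rintro ⟨x, ⟨a, ha, b, hb, hx⟩, c, hc, hz⟩
    obtain ⟨y, hy, hz⟩ := (key a b c).mp ⟨x, hx, hz⟩
    exact ⟨a, ha, y, ⟨b, hb, c, hc, hy⟩, hz⟩
  · rintro ⟨a, ha, x, ⟨b, hb, c, hc, hx⟩, hz⟩
    obtain ⟨y, hy, hz⟩ := (key a b c).mpr ⟨x, hx, hz⟩
    exact ⟨y, ⟨a, ha, b, hb, hy⟩, c, hc, hz⟩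

theorem smul_mono {A B C D : Set H} (h₁ : A ⊆ B) (h₂ : C ⊆ D) :
    hg.smul A C ⊆ hg.smul B D := by
  rintro z ⟨a, ha, c, hc, hz⟩
  exact ⟨a, h₁ ha, c, h₂ hc, hz⟩

variable {hg}

namespace IsClosed

variable {F : Set H}

theorem e_mem (hF : hg.IsClosed F) : hg.e ∈ F := by
  obtain ⟨⟨x, hx⟩, h⟩ := hF
  exact h ⟨_, ⟨x, hx, rfl⟩, x, hx, hg.e_mem_star_mul x⟩

theorem star_mem (hF : hg.IsClosed F) {x : H} (hx : x ∈ F) : hg.star x ∈ F :=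
  hF.2 ⟨_, ⟨x, hx, rfl⟩, hg.e, hF.e_mem, by simp [hg.idr]⟩

theorem hmul_subset (hF : hg.IsClosed F) {x y : H} (hx : x ∈ F) (hy : y ∈ F) :
    hg.hmul x y ⊆ F := fun _ hz =>
  hF.2 ⟨x, ⟨_, hF.star_mem hx, hg.star_star x⟩, y, hy, hz⟩

end IsClosed

theorem gen_singleton {p : H} (hp : hg.IsInvolution p) : hg.gen {p} = {hg.e, p} := by
  refine Set.Subset.antisymm (Set.sInter_subset_of_mem ⟨hp.2, by simp⟩) ?_
  refine Set.subset_sInter fun C hC => ?_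
  rintro x (rfl | rfl)
  · exact hC.1.e_mem
  · exact hC.2 rfl

theorem IsInvolution.star_eq {p : H} (hp : hg.IsInvolution p) : hg.star p = p := by
  rcases hp.2.star_mem (x := p) (by simp) with h | h
  · have h1 := hg.star_star p
    have h2 := hg.e_mem_star_mul p
    rw [h, hg.idl] at h2
    exact absurd h2.symm hp.1
  · exact h

/-! ### Products of commuting complexes -/

theorem smul_listProd_comm {A : Set H} {l : List (Set H)}
    (h : ∀ B ∈ l, hg.smul A B = hg.smul B A) :
    hg.smul A (hg.listProd l) = hg.smul (hg.listProd l) A := by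
  induction l with
  | nil => simp [listProd, e_smul, smul_e]
  | cons B l ih =>
    simp only [List.mem_cons, forall_eq_or_imp] at h
    rw [listProd, ← smul_assoc, h.1, smul_assoc, ih h.2, smul_assoc]

theorem smul_comm_of_hmul_comm (h : ∀ x y, hg.hmul x y = hg.hmul y x) (A B : Set H) :
    hg.smul A B = hg.smul B A := by
  ext z
  constructor <;>
  · rintro ⟨a, ha, b, hb, hz⟩
    exact ⟨b, hb, a, ha, h a b ▸ hz⟩

theorem e_mem_listProd {l : List (Set H)} (h : ∀ B ∈ l, hg.e ∈ B) : hg.e ∈ hg.listProd l := by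
  induction l with
  | nil => simp [listProd]
  | cons B l ih =>
    simp only [List.mem_cons, forall_eq_or_imp] at h
    exact ⟨_, h.1, _, ih h.2, by simp [hg.idl]⟩

theorem subset_listProd {l : List (Set H)} (h : ∀ B ∈ l, hg.e ∈ B) {B : Set H} (hB : B ∈ l) :
    B ⊆ hg.listProd l := by
  induction l with
  | nil => simp at hB
  | cons C l ih =>
    simp only [List.mem_cons, forall_eq_or_imp] at h
    intro x hx
    rcases List.mem_cons.mp hB with rfl | hB
    · exact ⟨x, hx, _, e_mem_listProd h.2, by simp [hg.idr]⟩
    · exact ⟨_, h.1, x, ih h.2 hB hx, by simp [hg.idl]⟩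

theorem listProd_mono {ι : Type*} {F G : ι → Set H} {l : List ι} (h : ∀ i ∈ l, F i ⊆ G i) :
    hg.listProd (l.map F) ⊆ hg.listProd (l.map G) := by
  induction l with
  | nil => simp
  | cons i l ih =>
    simp only [List.mem_cons, forall_eq_or_imp] at h
    exact smul_mono _ h.1 (ih h.2)

theorem mem_listProd_iff {ι : Type*} [DecidableEq ι] {F : ι → Set H} {l : List ι} (hl : l.Nodup)
    {z : H} : z ∈ hg.listProd (l.map F) ↔
      ∃ t : ι → H, (∀ i ∈ l, t i ∈ F i) ∧ z ∈ hg.listProd (l.map fun i => {t i}) := by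
  refine ⟨fun hz => ?_, ?_⟩
  · induction l generalizing z with
    | nil => exact ⟨fun _ => z, by simp, hz⟩
    | cons i l ih =>
      obtain ⟨a, ha, b, hb, hz⟩ := hz
      obtain ⟨hi, hl⟩ := List.nodup_cons.mp hl
      obtain ⟨t, ht, hb⟩ := ih hl hb
      have hne : ∀ j ∈ l, Function.update t i a j = t j := fun j hj =>
        Function.update_of_ne (by rintro rfl; exact hi hj) _ _
      refine ⟨Function.update t i a, ?_, ?_⟩
      · simp only [List.mem_cons, forall_eq_or_imp, Function.update_self]
        exact ⟨ha, fun j hj => hne j hj ▸ ht j hj⟩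
      · refine ⟨a, by simp, b, ?_, hz⟩
        rwa [List.map_congr_left fun j hj => by rw [hne j hj]]
  · rintro ⟨t, ht, hz⟩
    exact listProd_mono (fun i hi => Set.singleton_subset_iff.mpr (ht i hi)) hz

theorem listProd_singleton_nonempty {ι : Type*} (t : ι → H) (l : List ι) :
    (hg.listProd (l.map fun i => {t i})).Nonempty := by
  induction l with
  | nil => exact ⟨hg.e, rfl⟩
  | cons i l ih =>
    obtain ⟨b, hb⟩ := ih
    obtain ⟨z, hz⟩ := hg.hmul_nonempty (t i) b
    exact ⟨z, t i, rfl, b, hb, hz⟩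

section Commutative

variable (hc : ∀ A B : Set H, hg.smul A B = hg.smul B A)
include hc

theorem smul_smul_smul_comm (A B C D : Set H) :
    hg.smul (hg.smul A B) (hg.smul C D) = hg.smul (hg.smul A C) (hg.smul B D) := by
  rw [smul_assoc, smul_assoc, ← smul_assoc _ B, hc B C, smul_assoc]

theorem listProd_smul {ι : Type*} (F G : ι → Set H) (l : List ι) :
    hg.smul (hg.listProd (l.map F)) (hg.listProd (l.map G)) =
      hg.listProd (l.map fun i => hg.smul (F i) (G i)) := by
  induction l with
  | nil => simp [listProd, e_smul]
  | cons i l ih =>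
    simp only [List.map_cons, listProd]
    rw [smul_smul_smul_comm hc, ih]

theorem listProd_perm {l₁ l₂ : List (Set H)} (h : l₁.Perm l₂) :
    hg.listProd l₁ = hg.listProd l₂ := by
  induction h with
  | nil => rfl
  | cons A _ ih => simp only [listProd, ih]
  | swap A B l => simp only [listProd, ← smul_assoc, hc A B]
  | trans _ _ ih₁ ih₂ => exact ih₁.trans ih₂

theorem listProd_finRange_eq {n : ℕ} (F : Fin n → Set H) (i : Fin n) :
    hg.listProd ((List.finRange n).map F) = hg.smul (F i) (hg.cofactor F i) := by
  have h := List.perm_cons_erase (List.mem_finRange i)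
  rw [(List.nodup_finRange n).erase_eq_filter] at h
  rw [listProd_perm hc (h.map F), List.map_cons, listProd, cofactor]
  congr! 4
  funext j
  by_cases hj : j = i <;> simp [hj]

theorem isClosed_smul {F G : Set H} (hF : hg.IsClosed F) (hG : hg.IsClosed G) :
    hg.IsClosed (hg.smul F G) := by
  refine ⟨⟨hg.e, _, hF.e_mem, _, hG.e_mem, by simp [hg.idl]⟩, ?_⟩
  have hstar : hg.star '' hg.smul F G ⊆ hg.smul F G := by
    rintro _ ⟨x, ⟨a, ha, b, hb, hx⟩, rfl⟩
    have h : hg.star x ∈ hg.hmul (hg.star b) (hg.star a) := by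
      have h1 := (hg.h3l _ _ _).mp hx
      have h2 := (hg.h3r _ _ _).mp h1
      exact (hg.h3l _ _ _).mp h2
    rw [hc]
    exact ⟨_, hG.star_mem hb, _, hF.star_mem ha, h⟩
  refine (smul_mono _ hstar subset_rfl).trans ?_
  rw [smul_smul_smul_comm hc]
  refine smul_mono _ ?_ ?_
  · rintro z ⟨a, ha, b, hb, hz⟩
    exact hF.hmul_subset ha hb hz
  · rintro z ⟨a, ha, b, hb, hz⟩
    exact hG.hmul_subset ha hb hz

theorem isClosed_listProd {ι : Type*} {F : ι → Set H} (hF : ∀ i, hg.IsClosed (F i))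
    (l : List ι) : hg.IsClosed (hg.listProd (l.map F)) := by
  induction l with
  | nil =>
    refine ⟨⟨hg.e, rfl⟩, ?_⟩
    rintro z ⟨_, ⟨a, rfl, rfl⟩, _, rfl, hz⟩
    rw [hg.idr] at hz
    have := hg.e_mem_star_mul hg.e
    rw [hg.idr] at this
    exact hz.trans this.symm
  | cons i l ih => exact isClosed_smul hc (hF i) ih

end Commutative

end Hypergroup

theorem zmod_two_eq_zero_or_one (a : ZMod 2) : a = 0 ∨ a = 1 := by
  revert a
  decide

namespace EA2Data

open Hypergroup

variable {H : Type*} (E : EA2Data H)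

theorem fam_eq (i : Fin E.n) : E.fam i = {E.hg.e, E.q i} := gen_singleton (E.invol i)

theorem isClosed_fam (i : Fin E.n) : E.hg.IsClosed (E.fam i) := (E.dp.1 i).1

theorem q_injective : Function.Injective E.q := by
  intro i j hij
  by_contra hne
  have h : E.q i ∈ E.fam i ∩ E.hg.cofactor E.fam i := by
    refine ⟨by simp [fam_eq], ?_⟩
    refine subset_listProd (B := E.fam j) ?_ ?_ (by simp [fam_eq, hij])
    · simp only [List.mem_map]
      rintro _ ⟨k, -, rfl⟩
      exact (E.isClosed_fam k).e_mem
    · refine List.mem_map_of_mem ?_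
      simpa using fun h => hne h.symm
  exact (E.invol i).1 ((E.dp.2.2 i).subset h)

theorem hmul_q_comm (i j : Fin E.n) :
    E.hg.hmul (E.q i) (E.q j) = E.hg.hmul (E.q j) (E.q i) := by
  rcases eq_or_ne i j with rfl | hij
  · rfl
  have hmem : E.q i ∉ E.fam j := by
    simpa [fam_eq, (E.invol i).1] using fun h => hij (E.q_injective h)
  have hqj : E.q j ∈ E.fam j := by simp [fam_eq]
  have h₁ : E.q j ∉ E.hg.hmul (E.q i) (E.q j) := fun h => hmem <|
    (E.isClosed_fam j).hmul_subset hqj ((E.isClosed_fam j).star_mem hqj) ((E.hg.h3l _ _ _).mp h)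
  have h₂ : E.q j ∉ E.hg.hmul (E.q j) (E.q i) := fun h => hmem <|
    (E.isClosed_fam j).hmul_subset ((E.isClosed_fam j).star_mem hqj) hqj ((E.hg.h3r _ _ _).mp h)
  have h := (E.dp.1 i).2.2.2 (E.q j) (Set.mem_univ _)
  change E.hg.smul (E.fam i) _ = E.hg.smul _ (E.fam i) at h
  ext z
  have hz := Set.ext_iff.mp h z
  simp only [mem_smul, fam_eq, Set.mem_insert_iff, Set.mem_singleton_iff, exists_eq_left,
    exists_eq_or_imp, E.hg.idl, E.hg.idr] at hz
  by_cases hzj : z = E.q j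
  · rw [hzj]
    exact iff_of_false h₁ h₂
  · simpa [hzj] using hz

theorem exists_famProd_eq (x : H) : ∃ r, (∀ i, r i ∈ E.fam i) ∧ E.hg.famProd r = {x} := by
  have h : x ∈ E.hg.dcover E.fam x := by
    have := E.constrained x
    exact this.symm.subset rfl
  obtain ⟨r, hr, hx⟩ := h
  refine ⟨r, hr.1, Set.Subset.antisymm ?_ (by simpa using hx)⟩
  exact fun y hy => (E.constrained x).subset ⟨r, hr, hy⟩

theorem famProd_eq_of_mem {r : Fin E.n → H} (hr : ∀ i, r i ∈ E.fam i) {x : H}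
    (hx : x ∈ E.hg.famProd r) : E.hg.famProd r = {x} := by
  refine Set.Subset.antisymm (fun y hy => ?_) (by simpa using hx)
  exact (E.constrained x).subset ⟨r, ⟨hr, hx⟩, hy⟩

theorem hmul_comm (x y : H) : E.hg.hmul x y = E.hg.hmul y x := by
  obtain ⟨r, hr, hx⟩ := E.exists_famProd_eq x
  obtain ⟨s, hs, hy⟩ := E.exists_famProd_eq y
  rw [← smul_singleton, ← smul_singleton, ← hx, ← hy]
  have key : ∀ i j, E.hg.smul {r i} {s j} = E.hg.smul {s j} {r i} := fun i j => by
    have h₁ := hr i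
    have h₂ := hs j
    rw [fam_eq] at h₁ h₂
    rcases h₁ with h₁ | h₁
    · rw [h₁, e_smul, smul_e]
    rcases h₂ with h₂ | h₂
    · rw [h₂, e_smul, smul_e]
    rw [Set.mem_singleton_iff] at h₂
    rw [h₁, h₂, smul_singleton, smul_singleton, hmul_q_comm]
  refine smul_listProd_comm ?_
  simp only [List.mem_map]
  rintro _ ⟨j, -, rfl⟩
  refine (smul_listProd_comm ?_).symm
  simp only [List.mem_map]
  rintro _ ⟨i, -, rfl⟩
  exact (key i j).symm

theorem smul_comm (A B : Set H) : E.hg.smul A B = E.hg.smul B A :=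
  smul_comm_of_hmul_comm E.hmul_comm A B

theorem famProd_injOn {r s : Fin E.n → H} (hr : ∀ i, r i ∈ E.fam i) (hs : ∀ i, s i ∈ E.fam i)
    (h : E.hg.famProd r = E.hg.famProd s) : r = s := by
  funext i
  have hcl : E.hg.IsClosed (E.hg.cofactor E.fam i) := isClosed_listProd E.smul_comm E.isClosed_fam _
  have hsub : ∀ {t : Fin E.n → H}, (∀ j, t j ∈ E.fam j) →
      E.hg.cofactor (fun j => {t j}) i ⊆ E.hg.cofactor E.fam i := fun ht =>
    listProd_mono fun j _ => Set.singleton_subset_iff.mpr (ht j)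
  obtain ⟨x, hx⟩ : (E.hg.famProd r).Nonempty := listProd_singleton_nonempty _ _
  have hx' := hx
  rw [h] at hx'
  rw [famProd, listProd_finRange_eq E.smul_comm _ i] at hx hx'
  obtain ⟨_, rfl, a, ha, hxa⟩ := hx
  obtain ⟨_, rfl, b, hb, hxb⟩ := hx'
  have h₁ : r i ∈ E.hg.smul {s i} (E.hg.hmul b (E.hg.star a)) := by
    rw [← smul_singleton, ← smul_assoc]
    exact ⟨x, ⟨s i, rfl, b, rfl, hxb⟩, _, rfl, (E.hg.h3l _ _ _).mp hxa⟩
  obtain ⟨_, rfl, c, hc, hric⟩ := h₁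
  have hc₁ : c ∈ E.hg.cofactor E.fam i :=
    hcl.hmul_subset (hsub hs hb) (hcl.star_mem (hsub hr ha)) hc
  have hc₂ : c ∈ E.fam i := (E.isClosed_fam i).hmul_subset ((E.isClosed_fam i).star_mem (hs i))
    (hr i) ((E.hg.h3r _ _ _).mp hric)
  have hce : c = E.hg.e := (E.dp.2.2 i).subset ⟨hc₂, hc₁⟩
  rwa [hce, E.hg.idr] at hric

/-- The element `q i` or the identity, according to whether `a` is nonzero. -/
def gen₂ (i : Fin E.n) (a : ZMod 2) : H := if a = 0 then E.hg.e else E.q i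

theorem gen₂_mem (i : Fin E.n) (a : ZMod 2) : E.gen₂ i a ∈ E.fam i := by
  unfold gen₂
  split_ifs <;> simp [fam_eq]

theorem exists_gen₂_eq {i : Fin E.n} {x : H} (hx : x ∈ E.fam i) : ∃ a, E.gen₂ i a = x := by
  rw [fam_eq] at hx
  rcases hx with rfl | rfl
  · exact ⟨0, by simp [gen₂]⟩
  · exact ⟨1, by simp [gen₂]⟩

theorem gen₂_injective (i : Fin E.n) : Function.Injective (E.gen₂ i) := by
  intro a b h
  have := (E.invol i).1
  revert h
  rcases zmod_two_eq_zero_or_one a with rfl | rfl <;>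
    rcases zmod_two_eq_zero_or_one b with rfl | rfl <;> simp [gen₂, this, this.symm]

theorem exists_famProd_gen₂ (v : Fin E.n → ZMod 2) :
    ∃ x, E.hg.famProd (fun i => E.gen₂ i (v i)) = {x} := by
  obtain ⟨x, hx⟩ : (E.hg.famProd (fun i => E.gen₂ i (v i))).Nonempty :=
    listProd_singleton_nonempty _ _
  exact ⟨x, E.famProd_eq_of_mem (fun i => E.gen₂_mem i _) hx⟩

/-- The coordinate bijection of an elementary abelian 2-hypergroup. -/
noncomputable def coords : H ≃ (Fin E.n → ZMod 2) :=
  (Equiv.ofBijective (fun v => (E.exists_famProd_gen₂ v).choose) <| by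
    have hspec := fun v => (E.exists_famProd_gen₂ v).choose_spec
    constructor
    · intro v w h
      have h₁ := E.famProd_injOn (fun i => E.gen₂_mem i (v i)) (fun i => E.gen₂_mem i (w i))
        (by rw [hspec v, hspec w]; exact congrArg _ h)
      exact funext fun i => E.gen₂_injective i (congrFun h₁ i)
    · intro x
      obtain ⟨r, hr, hx⟩ := E.exists_famProd_eq x
      choose v hv using fun i => E.exists_gen₂_eq (hr i)
      refine ⟨v, ?_⟩
      have h : E.hg.famProd (fun i => E.gen₂ i (v i)) = {x} := by
        simp only [hv]
        exact hx
      exact Set.singleton_injective ((hspec v).symm.trans h)).symm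

theorem famProd_coords (x : H) : E.hg.famProd (fun i => E.gen₂ i (E.coords x i)) = {x} := by
  have h := (E.exists_famProd_gen₂ (E.coords x)).choose_spec
  have hx : (E.exists_famProd_gen₂ (E.coords x)).choose = x := E.coords.symm_apply_apply x
  rwa [hx] at h

theorem eq_gen₂_coords {x : H} {r : Fin E.n → H} (hr : ∀ i, r i ∈ E.fam i)
    (hx : x ∈ E.hg.famProd r) : r = fun i => E.gen₂ i (E.coords x i) :=
  E.famProd_injOn hr (fun i => E.gen₂_mem i _)
    ((E.famProd_eq_of_mem hr hx).trans (E.famProd_coords x).symm)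

/-- The indices of the thick generators. -/
def thickIdx : Set (Fin E.n) := {i | E.hg.IsThick (E.q i)}

theorem gen₂_mem_hmul_iff (i : Fin E.n) (a b c : ZMod 2) :
    E.gen₂ i c ∈ E.hg.hmul (E.gen₂ i a) (E.gen₂ i b) ↔
      c = a + b ∨ i ∈ E.thickIdx ∧ a ≠ 0 ∧ b ≠ 0 := by
  have hne := (E.invol i).1
  have hstar := (E.invol i).star_eq
  have he : E.hg.e ∈ E.hg.hmul (E.q i) (E.q i) := by simpa [hstar] using E.hg.e_mem_star_mul (E.q i)
  have hsub : E.hg.hmul (E.q i) (E.q i) ⊆ {E.hg.e, E.q i} :=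
    (E.invol i).2.hmul_subset (by simp) (by simp)
  have hq : E.q i ∈ E.hg.hmul (E.q i) (E.q i) ↔ i ∈ E.thickIdx := by
    change _ ↔ ¬ E.hg.hmul (E.hg.star (E.q i)) (E.q i) = {E.hg.e}
    rw [hstar]
    constructor
    · intro h h'
      rw [h'] at h
      exact hne h
    · intro h
      by_contra h'
      refine h (Set.Subset.antisymm (fun z hz => ?_) (by simpa using he))
      rcases hsub hz with rfl | rfl
      · rfl
      · exact absurd hz h'
  have h11 : (1 : ZMod 2) + 1 = 0 := rfl
  rcases zmod_two_eq_zero_or_one a with rfl | rfl <;>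
    rcases zmod_two_eq_zero_or_one b with rfl | rfl <;>
    rcases zmod_two_eq_zero_or_one c with rfl | rfl <;>
    simp [gen₂, E.hg.idl, E.hg.idr, hne, hne.symm, he, hq, h11]

theorem mem_hmul_iff {x y z : H} : z ∈ E.hg.hmul x y ↔ ∀ i,
    E.coords z i = E.coords x i + E.coords y i ∨
      i ∈ E.thickIdx ∧ E.coords x i ≠ 0 ∧ E.coords y i ≠ 0 := by
  simp only [← gen₂_mem_hmul_iff]
  rw [← smul_singleton, ← E.famProd_coords x, ← E.famProd_coords y, famProd, famProd,
    listProd_smul E.smul_comm, mem_listProd_iff (List.nodup_finRange _)]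
  simp only [smul_singleton, List.mem_finRange, true_imp_iff]
  constructor
  · rintro ⟨t, ht, hz⟩ i
    have := E.eq_gen₂_coords (fun i => (E.isClosed_fam i).hmul_subset (E.gen₂_mem i _)
      (E.gen₂_mem i _) (ht i)) hz
    have hi := ht i
    rwa [this] at hi
  · intro h
    exact ⟨_, h, (E.famProd_coords z).symm.subset rfl⟩

theorem coords_e : E.coords E.hg.e = 0 := by
  funext i
  have h : E.hg.e ∈ E.hg.famProd fun _ : Fin E.n => E.hg.e := by
    refine e_mem_listProd fun B hB => ?_
    simp only [List.mem_map] at hB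
    obtain ⟨_, _, rfl⟩ := hB
    rfl
  have := congrFun (E.eq_gen₂_coords (fun i => (E.isClosed_fam i).e_mem) h) i
  exact (E.gen₂_injective i (by simpa [gen₂] using this)).symm

theorem star_eq (x : H) : E.hg.star x = x := by
  refine (eq_star_of_e_mem (E.mem_hmul_iff.mpr fun i => Or.inl ?_)).symm
  rw [coords_e, Pi.zero_apply, CharTwo.add_self_eq_zero]

theorem support_eq (x : H) : E.support x = E.q '' {i | E.coords x i ≠ 0} := by
  ext y
  constructor
  · rintro ⟨hy, r, hr, i, rfl⟩
    rw [E.eq_gen₂_coords hr.1 hr.2] at hy ⊢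
    have h : E.coords x i ≠ 0 := fun h => hy (by simp [gen₂, h])
    exact ⟨i, h, by simp [gen₂, h]⟩
  · rintro ⟨i, hi, rfl⟩
    refine ⟨(E.invol i).1, _, ⟨fun i => E.gen₂_mem i _, (E.famProd_coords x).symm.subset rfl⟩,
      i, ?_⟩
    simp only [Set.mem_ofPred_eq] at hi
    simp [gen₂, hi]

theorem sElem_eq (x : H) : E.sElem x = {i ∈ E.thickIdx | E.coords x i ≠ 0}.ncard := by
  have h : {y ∈ E.support x | E.hg.IsThick y} =
      E.q '' {i ∈ E.thickIdx | E.coords x i ≠ 0} := by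
    rw [support_eq]
    ext y
    constructor
    · rintro ⟨⟨i, hi, rfl⟩, hy⟩
      exact ⟨i, ⟨hy, hi⟩, rfl⟩
    · rintro ⟨i, ⟨hy, hi⟩, rfl⟩
      exact ⟨⟨i, hi, rfl⟩, hy⟩
  rw [sElem, h, Set.ncard_image_of_injective _ E.q_injective]

end EA2Data

theorem prod_pow_sub_succ_succ (n k : ℕ) :
    ∏ i ∈ Finset.range (k + 1), ((2 : ℤ) ^ (n + 1) - 2 ^ i) =
      (2 ^ (n + 1) - 1) * (2 ^ k * ∏ i ∈ Finset.range k, ((2 : ℤ) ^ n - 2 ^ i)) := by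
  have h : ∀ i, (2 : ℤ) ^ (n + 1) - 2 ^ (i + 1) = 2 * (2 ^ n - 2 ^ i) := fun i => by ring
  rw [Finset.prod_range_succ', pow_zero, mul_comm]
  simp [h, Finset.prod_mul_distrib]

theorem gaussBinom2_mul_prod (n k : ℕ) :
    (gaussBinom2 n k : ℤ) * ∏ i ∈ Finset.range k, ((2 : ℤ) ^ k - 2 ^ i) =
      ∏ i ∈ Finset.range k, ((2 : ℤ) ^ n - 2 ^ i) := by
  induction n generalizing k with
  | zero =>
    cases k with
    | zero => simp [gaussBinom2]
    | succ k => simp [gaussBinom2, Finset.prod_range_succ']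
  | succ n ih =>
    cases k with
    | zero => simp [gaussBinom2]
    | succ k =>
      have h₁ := ih k
      have h₂ := ih (k + 1)
      rw [Finset.prod_range_succ (fun i => (2 : ℤ) ^ n - 2 ^ i) k] at h₂
      rw [prod_pow_sub_succ_succ] at h₂ ⊢
      rw [prod_pow_sub_succ_succ]
      push_cast [gaussBinom2]
      linear_combination (2 ^ (k + 1) - 1) * 2 ^ k * h₁ + 2 ^ (k + 1) * h₂

theorem gaussBinom2_eq_zero {n k : ℕ} (h : n < k) : gaussBinom2 n k = 0 := by
  induction n generalizing k with
  | zero => cases k with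
    | zero => omega
    | succ k => rfl
  | succ n ih => cases k with
    | zero => omega
    | succ k => simp [gaussBinom2, ih (show n < k by omega), ih (show n < k + 1 by omega)]

theorem gaussBinom2_pos {n k : ℕ} (h : k ≤ n) : 0 < gaussBinom2 n k := by
  induction n generalizing k with
  | zero =>
    obtain rfl := Nat.le_zero.mp h
    exact one_pos
  | succ n ih =>
    cases k with
    | zero => exact one_pos
    | succ k => exact Nat.add_pos_left (ih (by omega)) _

section Count

open Module

variable {V : Type*} [AddCommGroup V] [Module (ZMod 2) V] [Finite V]

theorem natCard_linearIndependent_zmod_two {k : ℕ} (hk : k ≤ finrank (ZMod 2) V) :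
    (Nat.card {s : Fin k → V // LinearIndependent (ZMod 2) s} : ℤ) =
      ∏ i ∈ Finset.range k, ((2 : ℤ) ^ finrank (ZMod 2) V - 2 ^ i) := by
  have := Fintype.ofFinite V
  rw [card_linearIndependent hk, ← Fin.prod_univ_eq_prod_range (fun i => (2 : ℤ) ^ _ - 2 ^ i)]
  push_cast
  refine Finset.prod_congr rfl fun i _ => ?_
  rw [Nat.cast_sub (by simpa using Nat.pow_le_pow_right two_pos (by omega))]
  simp

/-- A linearly independent family whose span is `U` is a linearly independent family in `U`
of full length. -/
def linearIndependentSpanEquiv {k : ℕ} (U : Submodule (ZMod 2) V) (hU : finrank (ZMod 2) U = k) :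
    {s : {s : Fin k → V // LinearIndependent (ZMod 2) s} //
      Submodule.span (ZMod 2) (Set.range s.1) = U} ≃
      {s : Fin k → U // LinearIndependent (ZMod 2) s} where
  toFun s := ⟨fun i => ⟨s.1.1 i, s.2.le (Submodule.subset_span ⟨i, rfl⟩)⟩,
    LinearIndependent.of_comp U.subtype s.1.2⟩
  invFun s := ⟨⟨fun i => s.1 i, s.2.map' U.subtype U.ker_subtype⟩, by
    have h := s.2.map' U.subtype U.ker_subtype
    refine Submodule.eq_of_le_of_finrank_eq ?_ ?_
    · rw [Submodule.span_le]
      rintro _ ⟨i, rfl⟩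
      exact (s.1 i).2
    · rw [hU]
      exact (finrank_span_eq_card h).trans (Fintype.card_fin k)⟩
  left_inv _ := rfl
  right_inv _ := rfl

theorem ncard_submodule_finrank_eq (k : ℕ) :
    {U : Submodule (ZMod 2) V | finrank (ZMod 2) U = k}.ncard =
      gaussBinom2 (finrank (ZMod 2) V) k := by
  rcases lt_or_ge (finrank (ZMod 2) V) k with hk | hk
  · rw [gaussBinom2_eq_zero hk, Set.ncard_eq_zero]
    refine Set.eq_empty_of_forall_notMem fun U hU => ?_
    have := U.finrank_le
    simp only [Set.mem_ofPred_eq] at hU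
    omega
  · let f : {s : Fin k → V // LinearIndependent (ZMod 2) s} →
        {U : Submodule (ZMod 2) V | finrank (ZMod 2) U = k} := fun s =>
      ⟨Submodule.span (ZMod 2) (Set.range s.1), by simpa using finrank_span_eq_card s.2⟩
    have hf : ∀ U, Nat.card {s // f s = U} =
        ∏ i ∈ Finset.range k, ((2 : ℤ) ^ k - 2 ^ i) := by
      rintro ⟨U, hU⟩
      have e := (Equiv.subtypeEquivRight fun s => Subtype.ext_iff (a1 := f s) (a2 := ⟨U, hU⟩)).trans
        (linearIndependentSpanEquiv U hU)
      rw [Nat.card_congr e, natCard_linearIndependent_zmod_two hU.ge, hU]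
    have hcard := natCard_linearIndependent_zmod_two hk
    have := Fintype.ofFinite {U : Submodule (ZMod 2) V | finrank (ZMod 2) U = k}
    rw [← Nat.card_congr (Equiv.sigmaFiberEquiv f), Nat.card_sigma] at hcard
    push_cast at hcard
    rw [Finset.sum_congr rfl fun U _ => hf U, Finset.sum_const, nsmul_eq_mul,
      ← gaussBinom2_mul_prod (finrank (ZMod 2) V)] at hcard
    have h0 : ∏ i ∈ Finset.range k, ((2 : ℤ) ^ k - 2 ^ i) ≠ 0 := by
      refine Finset.prod_ne_zero_iff.mpr fun i hi => sub_ne_zero.mpr fun h => ?_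
      have := pow_right_injective₀ (M₀ := ℤ) two_pos (by norm_num) h
      simp at hi
      omega
    have := mul_right_cancel₀ h0 hcard
    rw [← Nat.card_coe_set_eq, Nat.card_eq_fintype_card]
    exact_mod_cast this

theorem ncard_submodule_Icc_finrank_eq {K D : Submodule (ZMod 2) V} (h : Disjoint K D) (k : ℕ) :
    {U : Submodule (ZMod 2) V |
      (D ≤ U ∧ U ≤ K ⊔ D) ∧ finrank (ZMod 2) U = finrank (ZMod 2) D + k}.ncard =
      gaussBinom2 (finrank (ZMod 2) K) k := by
  rw [← ncard_submodule_finrank_eq]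
  have hf : ∀ U : Submodule (ZMod 2) K,
      (U.map K.subtype ⊔ D).comap K.subtype = U := fun U => by
    have h1 : (U.map K.subtype ⊔ D) ⊓ K = U.map K.subtype := by
      rw [sup_inf_assoc_of_le _ (Submodule.map_subtype_le K U), inf_comm, h.eq_bot, sup_bot_eq]
    refine Submodule.map_injective_of_injective K.injective_subtype ?_
    rw [Submodule.map_comap_subtype, inf_comm, h1]
  rw [← Set.ncard_image_of_injective {U : Submodule (ZMod 2) K | finrank (ZMod 2) U = k}
    (Function.LeftInverse.injective hf)]
  have hrank : ∀ U : Submodule (ZMod 2) K, finrank (ZMod 2) ↥(U.map K.subtype ⊔ D) =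
      finrank (ZMod 2) D + finrank (ZMod 2) U := fun U => by
    have h1 := Submodule.finrank_sup_add_finrank_inf_eq (U.map K.subtype) D
    rw [(h.mono_left (Submodule.map_subtype_le K U)).eq_bot, finrank_bot,
      (Submodule.equivMapOfInjective K.subtype K.injective_subtype U).finrank_eq.symm] at h1
    omega
  congr 1
  ext U
  constructor
  · rintro ⟨⟨h1, h2⟩, h3⟩
    have h4 : (U.comap K.subtype).map K.subtype ⊔ D = U := by
      rw [Submodule.map_comap_subtype, sup_comm, ← sup_inf_assoc_of_le _ h1, sup_comm,
        inf_eq_right.mpr h2]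
    refine ⟨U.comap K.subtype, ?_, h4⟩
    have := hrank (U.comap K.subtype)
    rw [h4] at this
    simp only [Set.mem_ofPred_eq]
    omega
  · rintro ⟨U, rfl, rfl⟩
    exact ⟨⟨le_sup_right, sup_le_sup_right (Submodule.map_subtype_le K U) D⟩, hrank U⟩
end Count

section Supported

variable {ι : Type*}

/-- The binary vectors vanishing outside `A`. -/
def supportedOn (A : Set ι) : Submodule (ZMod 2) (ι → ZMod 2) where
  carrier := {v | ∀ i ∉ A, v i = 0}
  zero_mem' := fun _ _ => rfl
  add_mem' := fun hv hw i hi => by simp [hv i hi, hw i hi]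
  smul_mem' := fun c v hv i hi => by simp [hv i hi]

theorem mem_supportedOn {A : Set ι} {v : ι → ZMod 2} :
    v ∈ supportedOn A ↔ ∀ i ∉ A, v i = 0 := Iff.rfl

theorem supportedOn_mono {A B : Set ι} (h : A ⊆ B) : supportedOn A ≤ supportedOn B :=
  fun _ hv i hi => hv i fun hA => hi (h hA)

theorem single_mem_supportedOn [DecidableEq ι] {A : Set ι} {i : ι} (hi : i ∈ A) :
    Pi.single i 1 ∈ supportedOn A := fun j hj =>
  Pi.single_eq_of_ne (by rintro rfl; exact hj hi) _

theorem supportedOn_le [Finite ι] [DecidableEq ι] {A : Set ι} {U : Submodule (ZMod 2) (ι → ZMod 2)}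
    (h : ∀ i ∈ A, Pi.single i 1 ∈ U) : supportedOn A ≤ U := by
  have := Fintype.ofFinite ι
  intro v hv
  rw [pi_eq_sum_univ' v]
  refine U.sum_mem fun i _ => ?_
  by_cases hi : i ∈ A
  · refine U.smul_mem _ ?_
    convert h i hi using 1
  · simp [hv i hi]

theorem disjoint_supportedOn {A B : Set ι} (h : Disjoint A B) :
    Disjoint (supportedOn A) (supportedOn B) := by
  rw [Submodule.disjoint_def]
  intro v hA hB
  funext i
  by_cases hi : i ∈ A
  · exact hB i (Set.disjoint_left.mp h hi)
  · exact hA i hi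

/-- Restriction of binary vectors to `A`, extended by zero. -/
noncomputable def indicatorMap (A : Set ι) : (ι → ZMod 2) →ₗ[ZMod 2] (ι → ZMod 2) where
  toFun v := A.indicator v
  map_add' v w := Set.indicator_add A v w
  map_smul' c v := Set.indicator_const_smul A c v

theorem indicatorMap_apply (A : Set ι) (v : ι → ZMod 2) : indicatorMap A v = A.indicator v := rfl

theorem indicatorMap_mem (A : Set ι) (v : ι → ZMod 2) : indicatorMap A v ∈ supportedOn A :=
  fun _ hi => Set.indicator_of_notMem hi v

theorem indicatorMap_add_compl (A : Set ι) (v : ι → ZMod 2) :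
    indicatorMap A v + indicatorMap Aᶜ v = v := Set.indicator_self_add_compl A v

theorem indicatorMap_of_mem {A : Set ι} {v : ι → ZMod 2} (hv : v ∈ supportedOn A) :
    indicatorMap A v = v :=
  Set.indicator_eq_self.mpr fun i hi => by_contra fun h => hi (hv i h)

theorem indicatorMap_of_mem_compl {A : Set ι} {v : ι → ZMod 2} (hv : v ∈ supportedOn Aᶜ) :
    indicatorMap A v = 0 := by
  have := indicatorMap_add_compl A v
  rwa [indicatorMap_of_mem hv, add_eq_right] at this

theorem finrank_supportedOn [Finite ι] (A : Set ι) :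
    Module.finrank (ZMod 2) (supportedOn A) = A.ncard := by
  classical
  have := Fintype.ofFinite ι
  have h : supportedOn A = ⨅ i ∈ Aᶜ, LinearMap.ker (LinearMap.proj i) := by
    ext
    simp [mem_supportedOn, Submodule.mem_iInf]
  rw [h, (LinearMap.iInfKerProjEquiv (ZMod 2) (fun _ : ι => ZMod 2)
    (disjoint_compl_right (a := A)) (by simp)).finrank_eq, Module.finrank_fintype_fun_eq_card,
    ← Nat.card_coe_set_eq, Nat.card_eq_fintype_card]

end Supported

namespace EA2Data

open Hypergroup Module

variable {H : Type*} (E : EA2Data H)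

theorem mem_hmul_iff_sub {x y z : H} : z ∈ E.hg.hmul x y ↔
    E.coords z - (E.coords x + E.coords y) ∈
      supportedOn {i ∈ E.thickIdx | E.coords x i ≠ 0 ∧ E.coords y i ≠ 0} := by
  rw [mem_hmul_iff, mem_supportedOn]
  refine forall_congr' fun i => ?_
  rw [Pi.sub_apply, sub_eq_zero, Set.mem_ofPred_eq, Pi.add_apply]
  tauto

/-- The thick indices occurring in a subspace. -/
def thickSupp (U : Submodule (ZMod 2) (Fin E.n → ZMod 2)) : Set (Fin E.n) :=
  {i ∈ E.thickIdx | ∃ v ∈ U, v i ≠ 0}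

/-- The subset of `H` with coordinates in a subspace. -/
def ofSub (U : Submodule (ZMod 2) (Fin E.n → ZMod 2)) : Set H := {x | E.coords x ∈ U}

variable {E}
variable {U V : Submodule (ZMod 2) (Fin E.n → ZMod 2)}

theorem mem_ofSub {x : H} : x ∈ E.ofSub U ↔ E.coords x ∈ U := Iff.rfl

theorem ofSub_subset : E.ofSub U ⊆ E.ofSub V ↔ U ≤ V := by
  refine ⟨fun h v hv => ?_, fun h x hx => h hx⟩
  simpa [mem_ofSub] using @h (E.coords.symm v) (by simpa [mem_ofSub] using hv)

theorem ofSub_injective : Function.Injective E.ofSub := fun _ _ h =>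
  le_antisymm (ofSub_subset.mp h.subset) (ofSub_subset.mp h.symm.subset)

theorem ncard_ofSub : (E.ofSub U).ncard = 2 ^ finrank (ZMod 2) U := by
  rw [← Nat.card_coe_set_eq,
    Nat.card_congr (E.coords.subtypeEquiv (p := (· ∈ E.ofSub U)) (q := (· ∈ U)) fun _ => Iff.rfl),
    Module.natCard_eq_pow_finrank (K := ZMod 2), Nat.card_zmod]

theorem exists_ofSub_eq {F : Set H} (hF : E.hg.IsClosed F) : ∃ U, E.ofSub U = F := by
  refine ⟨AddSubgroup.toZModSubmodule 2
    { carrier := {v | E.coords.symm v ∈ F}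
      zero_mem' := ?_
      add_mem' := ?_
      neg_mem' := ?_ }, ?_⟩
  · intro v w hv hw
    refine hF.hmul_subset hv hw (E.mem_hmul_iff.mpr fun i => Or.inl ?_)
    simp
  · have := hF.e_mem
    rwa [← E.coords.symm_apply_apply E.hg.e, coords_e] at this
  · intro v hv
    rwa [ZModModule.neg_eq_self]
  · ext x
    simp [mem_ofSub, AddSubgroup.mem_toZModSubmodule]

theorem isClosed_ofSub_iff : E.hg.IsClosed (E.ofSub U) ↔ supportedOn (E.thickSupp U) ≤ U := by
  constructor
  · refine fun h => supportedOn_le ?_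
    rintro i ⟨hi, v, hv, hvi⟩
    have hv' : E.coords.symm v ∈ E.ofSub U := by simpa [mem_ofSub] using hv
    have hm : E.coords.symm (Pi.single i 1) ∈ E.hg.hmul (E.coords.symm v) (E.coords.symm v) := by
      rw [mem_hmul_iff_sub, ZModModule.add_self, sub_zero]
      simp only [Equiv.apply_symm_apply]
      exact single_mem_supportedOn ⟨hi, hvi, hvi⟩
    simpa [mem_ofSub] using h.hmul_subset hv' hv' hm
  · intro h
    refine ⟨⟨E.hg.e, by simp [mem_ofSub, coords_e]⟩, ?_⟩
    rintro z ⟨_, ⟨x, hx, rfl⟩, y, hy, hz⟩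
    rw [star_eq, mem_hmul_iff_sub] at hz
    rw [mem_ofSub] at hx hy ⊢
    rw [← sub_add_cancel (E.coords z) (E.coords x + E.coords y)]
    refine U.add_mem (h (supportedOn_mono ?_ hz)) (U.add_mem hx hy)
    exact fun i hi => ⟨hi.1, _, hx, hi.2.1⟩

theorem isStronglyNormal_ofSub_iff (hV : E.hg.IsClosed (E.ofSub V)) :
    E.hg.IsStronglyNormal (E.ofSub U) (E.ofSub V) ↔ supportedOn (E.thickSupp V) ≤ U ∧ U ≤ V := by
  constructor
  · rintro ⟨hU, -, hUV, h⟩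
    refine ⟨supportedOn_le ?_, ofSub_subset.mp hUV⟩
    rintro i ⟨hi, v, hv, hvi⟩
    have hv' : E.coords.symm v ∈ E.ofSub V := by simpa [mem_ofSub] using hv
    have hm : E.coords.symm (Pi.single i 1) ∈ E.hg.hmul (E.coords.symm v) (E.coords.symm v) := by
      rw [mem_hmul_iff_sub, ZModModule.add_self, sub_zero]
      simp only [Equiv.apply_symm_apply]
      exact single_mem_supportedOn ⟨hi, hvi, hvi⟩
    have := h _ hv' ⟨_, ⟨_, rfl, _, hU.e_mem, by rw [star_eq, E.hg.idr]; rfl⟩, _, rfl, hm⟩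
    simpa [mem_ofSub] using this
  · rintro ⟨hDU, hUV⟩
    refine ⟨isClosed_ofSub_iff.mpr ((supportedOn_mono ?_).trans hDU), hV, ofSub_subset.mpr hUV, ?_⟩
    · rintro i ⟨hi, v, hv, hvi⟩
      exact ⟨hi, v, hUV hv, hvi⟩
    · rintro p hp z ⟨w, ⟨_, rfl, f, hf, hw⟩, p', hp', hz⟩
      rw [star_eq, mem_hmul_iff_sub] at hw
      rw [Set.mem_singleton_iff.mp hp', mem_hmul_iff_sub] at hz
      rw [mem_ofSub] at hp hf ⊢
      have hw' : E.coords w - (E.coords p + E.coords f) ∈ U := by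
        refine hDU (supportedOn_mono ?_ hw)
        exact fun i hi => ⟨hi.1, _, hp, hi.2.1⟩
      have hz' : E.coords z - (E.coords w + E.coords p) ∈ U := by
        refine hDU (supportedOn_mono ?_ hz)
        exact fun i hi => ⟨hi.1, _, hp, hi.2.2⟩
      have h2 : E.coords p + E.coords p = 0 := ZModModule.add_self _
      have : E.coords z = (E.coords z - (E.coords w + E.coords p)) +
          (E.coords w - (E.coords p + E.coords f)) + E.coords f + (E.coords p + E.coords p) := by
        abel
      rw [this, h2, add_zero]
      exact U.add_mem (U.add_mem hz' hw') hf

theorem isThin_iff {x : H} : E.hg.IsThin x ↔ E.coords x ∈ supportedOn E.thickIdxᶜ := by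
  rw [IsThin, star_eq]
  constructor
  · intro h i hi
    rw [Set.notMem_compl_iff] at hi
    by_contra hxi
    have hm : E.coords.symm (Pi.single i 1) ∈ E.hg.hmul x x := by
      rw [mem_hmul_iff_sub, ZModModule.add_self, sub_zero, Equiv.apply_symm_apply]
      exact single_mem_supportedOn ⟨hi, hxi, hxi⟩
    rw [h, Set.mem_singleton_iff, Equiv.symm_apply_eq, coords_e] at hm
    simpa using congrFun hm i
  · intro h
    ext z
    rw [mem_hmul_iff_sub, ZModModule.add_self, sub_zero, Set.mem_singleton_iff,
      ← E.coords.apply_eq_iff_eq, coords_e]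
    refine ⟨fun hz => funext fun i => hz i ?_, fun hz => hz ▸ Submodule.zero_mem _⟩
    rintro ⟨hi, hxi, -⟩
    exact hxi (h i (by simpa using hi))

theorem sSet_ofSub (hV : E.hg.IsClosed (E.ofSub V)) :
    E.sSet (E.ofSub V) = finrank (ZMod 2) (supportedOn (E.thickSupp V)) := by
  rw [finrank_supportedOn]
  refine IsGreatest.csSup_eq ⟨?_, ?_⟩
  · have hv : indicatorMap (E.thickSupp V) 1 ∈ V :=
      isClosed_ofSub_iff.mp hV (indicatorMap_mem _ _)
    refine ⟨E.coords.symm (indicatorMap (E.thickSupp V) 1), by simpa [mem_ofSub] using hv, ?_⟩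
    rw [sElem_eq]
    congr 1
    ext i
    simp only [Equiv.apply_symm_apply, indicatorMap_apply, Set.mem_ofPred_eq]
    by_cases hi : i ∈ E.thickSupp V
    · simp [hi, hi.1]
    · simp [hi]
  · rintro _ ⟨a, ha, rfl⟩
    rw [sElem_eq]
    exact Set.ncard_le_ncard (fun i hi => ⟨hi.1, _, ha, hi.2⟩) (Set.toFinite _)

theorem rank2_ofSub :
    E.hg.rank2 (E.ofSub V) = finrank (ZMod 2) ↥(V ⊓ supportedOn E.thickIdxᶜ) := by
  refine IsGreatest.csSup_eq ⟨?_, ?_⟩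
  · refine ⟨E.ofSub (V ⊓ supportedOn E.thickIdxᶜ), isClosed_ofSub_iff.mpr ?_,
      ofSub_subset.mpr inf_le_left, fun u hu => isThin_iff.mpr hu.2, fun u _ => E.star_eq u,
      ncard_ofSub⟩
    refine supportedOn_le ?_
    rintro i ⟨hi, v, hv, hvi⟩
    exact absurd (hv.2 i (by simpa using hi)) hvi
  · rintro k ⟨F, hF, hFV, hthin, -, hcard⟩
    obtain ⟨U, rfl⟩ := exists_ofSub_eq hF
    rw [ncard_ofSub] at hcard
    rw [← Nat.pow_right_injective le_rfl hcard]
    refine Submodule.finrank_mono (le_inf (ofSub_subset.mp hFV) fun v hv => ?_)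
    simpa using isThin_iff.mp (hthin (E.coords.symm v) (by simpa [mem_ofSub] using hv))

theorem inf_sup_thickSupp (hV : supportedOn (E.thickSupp V) ≤ V) :
    V ⊓ supportedOn E.thickIdxᶜ ⊔ supportedOn (E.thickSupp V) = V := by
  refine le_antisymm (sup_le inf_le_left hV) fun v hv => ?_
  have h₁ : indicatorMap E.thickIdx v ∈ supportedOn (E.thickSupp V) := by
    intro i hi
    by_cases hiT : i ∈ E.thickIdx
    · rw [indicatorMap_apply, Set.indicator_of_mem hiT]
      by_contra hvi
      exact hi ⟨hiT, v, hv, hvi⟩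
    · exact indicatorMap_mem _ _ i hiT
  have h₂ := indicatorMap_add_compl E.thickIdx v
  refine Submodule.mem_sup.mpr ⟨indicatorMap E.thickIdxᶜ v, ⟨?_, indicatorMap_mem _ _⟩, _, h₁, ?_⟩
  · rw [← eq_sub_iff_add_eq'] at h₂
    rw [h₂]
    exact V.sub_mem hv (hV h₁)
  · rw [add_comm, h₂]

theorem disjoint_inf_thickSupp (W : Submodule (ZMod 2) (Fin E.n → ZMod 2)) :
    Disjoint (W ⊓ supportedOn E.thickIdxᶜ) (supportedOn (E.thickSupp V)) :=
  (disjoint_supportedOn (Set.disjoint_compl_left_iff_subset.mpr fun _ hi => hi.1)).mono_left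
    inf_le_right

theorem ncard_isStronglyNormal (hV : E.hg.IsClosed (E.ofSub V)) (r : ℕ) :
    {F | E.hg.IsStronglyNormal F (E.ofSub V) ∧ F.ncard = 2 ^ r}.ncard =
      {U | (supportedOn (E.thickSupp V) ≤ U ∧ U ≤ V) ∧ finrank (ZMod 2) U = r}.ncard := by
  rw [← Set.ncard_image_of_injective _ (ofSub_injective (E := E))]
  congr 1
  ext F
  constructor
  · rintro ⟨hF, hr⟩
    obtain ⟨U, rfl⟩ := exists_ofSub_eq hF.1
    rw [ncard_ofSub] at hr
    exact ⟨U, ⟨(isStronglyNormal_ofSub_iff hV).mp hF, Nat.pow_right_injective le_rfl hr⟩, rfl⟩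
  · rintro ⟨U, ⟨hU, rfl⟩, rfl⟩
    exact ⟨(isStronglyNormal_ofSub_iff hV).mpr hU, ncard_ofSub⟩

theorem ncard_isStronglyNormal_add (hV : E.hg.IsClosed (E.ofSub V)) (k : ℕ) :
    {F | E.hg.IsStronglyNormal F (E.ofSub V) ∧
      F.ncard = 2 ^ (E.sSet (E.ofSub V) + k)}.ncard =
      gaussBinom2 (E.hg.rank2 (E.ofSub V)) k := by
  rw [ncard_isStronglyNormal hV, rank2_ofSub, sSet_ofSub hV,
    ← ncard_submodule_Icc_finrank_eq (disjoint_inf_thickSupp (V := V) V),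
    inf_sup_thickSupp (isClosed_ofSub_iff.mp hV)]

theorem isIso_of_linearMap {L : (Fin E.n → ZMod 2) →ₗ[ZMod 2] (Fin E.n → ZMod 2)}
    (hL : Set.BijOn L U V) (hL₁ : ∀ v, ∀ i ∈ E.thickIdx, L v i = v i)
    (hL₂ : ∀ v ∈ supportedOn E.thickIdx, L v = v) :
    E.hg.IsIso (E.ofSub U) (E.ofSub V) fun x => E.coords.symm (L (E.coords x)) := by
  refine ⟨⟨?_, ?_, ?_⟩, by simp [coords_e, E.coords.symm_apply_eq], ?_⟩
  · intro x hx
    simpa [mem_ofSub] using hL.mapsTo hx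
  · intro x hx y hy h
    exact E.coords.injective (hL.injOn hx hy (E.coords.symm.injective h))
  · intro y hy
    obtain ⟨v, hv, hvy⟩ := hL.surjOn hy
    exact ⟨E.coords.symm v, by simpa [mem_ofSub] using hv, by simp [hvy]⟩
  · intro p _ q _
    have hset : {i ∈ E.thickIdx | L (E.coords p) i ≠ 0 ∧ L (E.coords q) i ≠ 0} =
        {i ∈ E.thickIdx | E.coords p i ≠ 0 ∧ E.coords q i ≠ 0} := by
      ext i
      simp +contextual only [Set.mem_ofPred_eq, and_congr_right_iff, hL₁, implies_true]
    ext z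
    rw [mem_hmul_iff_sub]
    simp only [Equiv.apply_symm_apply, hset, ← map_add]
    constructor
    · rintro ⟨x, hx, rfl⟩
      rw [mem_hmul_iff_sub] at hx
      rw [Equiv.apply_symm_apply, ← map_sub, hL₂ _ (supportedOn_mono (fun i hi => hi.1) hx)]
      exact hx
    · intro hz
      refine ⟨E.coords.symm (E.coords p + E.coords q +
        (E.coords z - L (E.coords p + E.coords q))), ?_, ?_⟩
      · rw [mem_hmul_iff_sub]
        simpa using hz
      · have := hL₂ _ (supportedOn_mono (fun i hi => hi.1) hz)
        simp only [Equiv.apply_symm_apply]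
        rw [map_add L (_ + _), this, add_sub_cancel, Equiv.symm_apply_apply]

theorem isomorphic_of_finrank_eq {U₁ U₂ : Submodule (ZMod 2) (Fin E.n → ZMod 2)}
    (hV : E.hg.IsClosed (E.ofSub V))
    (h₁ : supportedOn (E.thickSupp V) ≤ U₁ ∧ U₁ ≤ V)
    (h₂ : supportedOn (E.thickSupp V) ≤ U₂ ∧ U₂ ≤ V)
    (h : finrank (ZMod 2) U₁ = finrank (ZMod 2) U₂) :
    E.hg.Isomorphic (E.ofSub U₁) (E.ofSub U₂) := by
  set D := supportedOn (E.thickSupp V)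
  set K := supportedOn E.thickIdxᶜ
  have hsup : ∀ {U}, D ≤ U ∧ U ≤ V → U ⊓ K ⊔ D = U := fun {U} hU => by
    rw [inf_sup_assoc_of_le _ hU.1, inf_eq_left]
    exact hU.2.trans ((inf_sup_thickSupp (isClosed_ofSub_iff.mp hV)).ge.trans
      (sup_le_sup_right inf_le_right _))
  have hrank : ∀ {U}, D ≤ U ∧ U ≤ V →
      finrank (ZMod 2) U = finrank (ZMod 2) ↥(U ⊓ K) + finrank (ZMod 2) D := fun {U} hU => by
    have := Submodule.finrank_sup_add_finrank_inf_eq (U ⊓ K) D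
    rwa [hsup hU, (disjoint_inf_thickSupp U).eq_bot, finrank_bot, add_zero] at this
  have hD : D ≤ supportedOn E.thickIdx := supportedOn_mono fun i hi => hi.1
  let g : ↥(U₁ ⊓ K) ≃ₗ[ZMod 2] ↥(U₂ ⊓ K) := LinearEquiv.ofFinrankEq _ _ (by
    have := hrank h₁
    have := hrank h₂
    omega)
  obtain ⟨g', hg'⟩ := LinearMap.exists_extend g.toLinearMap
  have hg : ∀ v (hv : v ∈ U₁ ⊓ K), g' v = g ⟨v, hv⟩ := fun v hv => LinearMap.congr_fun hg' ⟨v, hv⟩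
  let L : (Fin E.n → ZMod 2) →ₗ[ZMod 2] (Fin E.n → ZMod 2) :=
    indicatorMap E.thickIdx + (U₂ ⊓ K).subtype ∘ₗ g' ∘ₗ indicatorMap E.thickIdxᶜ
  have hL : ∀ v, L v = indicatorMap E.thickIdx v + g' (indicatorMap E.thickIdxᶜ v) :=
    fun _ => rfl
  have hLD : ∀ v ∈ supportedOn E.thickIdx, L v = v := fun v hv => by
    rw [hL, indicatorMap_of_mem hv, indicatorMap_of_mem_compl (by rwa [compl_compl])]
    simp
  have hLK : ∀ v (hv : v ∈ U₁ ⊓ K), L v = g ⟨v, hv⟩ := fun v hv => by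
    rw [hL, indicatorMap_of_mem_compl hv.2, indicatorMap_of_mem hv.2, hg v hv, zero_add]
  have hLT : ∀ v, ∀ i ∈ E.thickIdx, L v i = v i := fun v i hi => by
    have := (g' (indicatorMap E.thickIdxᶜ v)).2.2 i (by simpa using hi)
    rw [hL, Pi.add_apply, this, add_zero, indicatorMap_apply, Set.indicator_of_mem hi]
  refine ⟨_, isIso_of_linearMap (L := L) ⟨?_, ?_, ?_⟩ hLT hLD⟩
  · intro v hv
    rw [SetLike.mem_coe, ← hsup h₁] at hv
    obtain ⟨k, hk, d, hd, rfl⟩ := Submodule.mem_sup.mp hv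
    rw [SetLike.mem_coe, map_add, hLK k hk, hLD d (hD hd)]
    exact U₂.add_mem (g ⟨k, hk⟩).2.1 (h₂.1 hd)
  · refine LinearMap.injOn_of_disjoint_ker subset_rfl (Submodule.disjoint_def.mpr fun v hv hv0 => ?_)
    rw [LinearMap.mem_ker] at hv0
    have hvK : v ∈ K := fun i hi => by
      rw [← hLT v i (by simpa using hi), hv0]
      rfl
    have := hLK v ⟨hv, hvK⟩
    rw [hv0] at this
    have := g.map_eq_zero_iff.mp (Subtype.ext this.symm)
    exact congrArg Subtype.val this
  · intro v hv
    rw [SetLike.mem_coe, ← hsup h₂] at hv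
    obtain ⟨k, hk, d, hd, rfl⟩ := Submodule.mem_sup.mp hv
    refine ⟨g.symm ⟨k, hk⟩ + d, U₁.add_mem (g.symm ⟨k, hk⟩).2.1 (h₁.1 hd), ?_⟩
    rw [map_add, hLK _ (g.symm ⟨k, hk⟩).2, hLD d (hD hd)]
    simp

theorem isomorphic_iff_ncard_eq (hV : E.hg.IsClosed (E.ofSub V)) {F₁ F₂ : Set H}
    (h₁ : E.hg.IsStronglyNormal F₁ (E.ofSub V)) (h₂ : E.hg.IsStronglyNormal F₂ (E.ofSub V)) :
    E.hg.Isomorphic F₁ F₂ ↔ F₁.ncard = F₂.ncard := by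
  constructor
  · rintro ⟨α, hα, -⟩
    rw [← hα.image_eq, hα.injOn.ncard_image]
  · intro h
    obtain ⟨U₁, rfl⟩ := exists_ofSub_eq h₁.1
    obtain ⟨U₂, rfl⟩ := exists_ofSub_eq h₂.1
    rw [ncard_ofSub, ncard_ofSub] at h
    exact isomorphic_of_finrank_eq hV ((isStronglyNormal_ofSub_iff hV).mp h₁)
      ((isStronglyNormal_ofSub_iff hV).mp h₂) (Nat.pow_right_injective le_rfl h)

theorem exists_ncard_eq_of_isStronglyNormal (hV : E.hg.IsClosed (E.ofSub V)) {F : Set H}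
    (hF : E.hg.IsStronglyNormal F (E.ofSub V)) :
    ∃ k ≤ E.hg.rank2 (E.ofSub V), F.ncard = 2 ^ (E.sSet (E.ofSub V) + k) := by
  obtain ⟨U, rfl⟩ := exists_ofSub_eq hF.1
  obtain ⟨hDU, hUV⟩ := (isStronglyNormal_ofSub_iff hV).mp hF
  have hD := Submodule.finrank_mono hDU
  have hU := Submodule.finrank_mono hUV
  have hrank := Submodule.finrank_sup_add_finrank_inf_eq (V ⊓ supportedOn E.thickIdxᶜ)
    (supportedOn (E.thickSupp V))
  rw [inf_sup_thickSupp (isClosed_ofSub_iff.mp hV), (disjoint_inf_thickSupp V).eq_bot,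
    finrank_bot, add_zero, ← rank2_ofSub, ← sSet_ofSub hV] at hrank
  rw [← sSet_ofSub hV] at hD
  refine ⟨finrank (ZMod 2) U - E.sSet (E.ofSub V), by omega, ?_⟩
  rw [ncard_ofSub, Nat.add_sub_cancel' hD]

theorem exists_isStronglyNormal_ncard_eq (hV : E.hg.IsClosed (E.ofSub V)) {k : ℕ}
    (hk : k ≤ E.hg.rank2 (E.ofSub V)) : ∃ F, E.hg.IsStronglyNormal F (E.ofSub V) ∧
      F.ncard = 2 ^ (E.sSet (E.ofSub V) + k) := by
  refine Set.nonempty_of_ncard_ne_zero (s := {F | E.hg.IsStronglyNormal F (E.ofSub V) ∧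
    F.ncard = 2 ^ (E.sSet (E.ofSub V) + k)}) ?_
  rw [ncard_isStronglyNormal_add hV]
  exact (gaussBinom2_pos hk).ne'

theorem ncard_isomorphismClasses (hV : E.hg.IsClosed (E.ofSub V)) :
    {C : Set (Set H) | ∃ D : Set H, E.hg.IsStronglyNormal D (E.ofSub V) ∧
        C = {F : Set H | E.hg.IsStronglyNormal F (E.ofSub V) ∧ E.hg.Isomorphic D F}}.ncard
      = E.hg.rank2 (E.ofSub V) + 1 := by
  have hclass : ∀ {D k}, E.hg.IsStronglyNormal D (E.ofSub V) →
      D.ncard = 2 ^ (E.sSet (E.ofSub V) + k) →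
      {F | E.hg.IsStronglyNormal F (E.ofSub V) ∧ E.hg.Isomorphic D F} =
        {F | E.hg.IsStronglyNormal F (E.ofSub V) ∧
          F.ncard = 2 ^ (E.sSet (E.ofSub V) + k)} := fun hD hk => by
    ext F
    refine and_congr_right fun hF => ?_
    rw [isomorphic_iff_ncard_eq hV hD hF, hk, eq_comm]
  have himage : {C : Set (Set H) | ∃ D : Set H, E.hg.IsStronglyNormal D (E.ofSub V) ∧
      C = {F : Set H | E.hg.IsStronglyNormal F (E.ofSub V) ∧ E.hg.Isomorphic D F}} =
      (fun k => {F | E.hg.IsStronglyNormal F (E.ofSub V) ∧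
        F.ncard = 2 ^ (E.sSet (E.ofSub V) + k)}) '' Set.Iic (E.hg.rank2 (E.ofSub V)) := by
    ext C
    constructor
    · rintro ⟨D, hD, rfl⟩
      obtain ⟨k, hk, hDk⟩ := exists_ncard_eq_of_isStronglyNormal hV hD
      exact ⟨k, hk, (hclass hD hDk).symm⟩
    · rintro ⟨k, hk, rfl⟩
      obtain ⟨D, hD, hDk⟩ := exists_isStronglyNormal_ncard_eq hV hk
      exact ⟨D, hD, (hclass hD hDk).symm⟩
  rw [himage, Set.InjOn.ncard_image, Set.ncard_eq_toFinset_card', Set.toFinset_Iic,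
    Nat.card_Iic]
  intro k hk l _ hkl
  obtain ⟨D, hD⟩ := exists_isStronglyNormal_ncard_eq hV hk
  have hD' := Set.ext_iff.mp hkl D |>.mp hD
  have := Nat.pow_right_injective le_rfl (hD.2.symm.trans hD'.2)
  omega

end EA2Data

end HyperPaper

/-- For a closed subset G of an elementary abelian 2-hypergroup H and
r ∈ ℕ₀: the number of strongly normal closed subsets of G with 2^r elements is 0 if
r < s(G) and C(r_2(G), r − s(G))_2 otherwise; moreover the number of pairwise
nonisomorphic strongly normal closed subsets of G equals r_2(G) + 1. -/
theorem stmt19 {H : Type*} (E : EA2Data H) (G : Set H) (hG : E.hg.IsClosed G) (r : ℕ) :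
    (r < E.sSet G →
      {F : Set H | E.hg.IsStronglyNormal F G ∧ F.ncard = 2 ^ r}.ncard = 0) ∧
    (E.sSet G ≤ r →
      {F : Set H | E.hg.IsStronglyNormal F G ∧ F.ncard = 2 ^ r}.ncard
        = gaussBinom2 (E.hg.rank2 G) (r - E.sSet G)) ∧
    {C : Set (Set H) | ∃ D : Set H, E.hg.IsStronglyNormal D G ∧
        C = {F : Set H | E.hg.IsStronglyNormal F G ∧ E.hg.Isomorphic D F}}.ncard
      = E.hg.rank2 G + 1 := by
  obtain ⟨V, rfl⟩ := EA2Data.exists_ofSub_eq hG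
  refine ⟨fun hr => ?_, fun hr => ?_, EA2Data.ncard_isomorphismClasses hG⟩
  · rw [Set.ncard_eq_zero (Set.Finite.subset (Set.finite_univ_iff.mpr ?_) (Set.subset_univ _))]
    · refine Set.eq_empty_of_forall_notMem ?_
      rintro F ⟨hF, hcard⟩
      obtain ⟨k, -, hk⟩ := EA2Data.exists_ncard_eq_of_isStronglyNormal hG hF
      have := Nat.pow_right_injective le_rfl (hcard.symm.trans hk)
      omega
    · have : Finite H := .of_equiv _ E.coords.symm
      infer_instance
  · rw [← EA2Data.ncard_isStronglyNormal_add hG, Nat.add_sub_cancel' hr]
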